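/- In the binary classification model, assume max_{j=1,…,M} ‖φ_j‖_{P_X,∞} ≤ L_φ for some L_φ > 0, and let Φ : ℝ → [0,∞) be convex and twice continuously differentiable with β_Φ := sup_{|u| ≤ RL_φ} Φ′(u)²/Φ″(u) < ∞ (with the convention 0/0 = 0). Then the mirror averaging aggregate f̂_n defined with temperature β ≥ β_Φ and the sparsity prior (parameters M ≥ 2, τ > 0, R > 2Mτ) satisfies: E[ℓ_Φ(f̂_n, f)] ≤ min over λ* with ‖λ*‖₁ ≤ R − 2Mτ of ( ℓ_Φ(f_{λ*}, f) + (4β/(n+1)) ∑_{j=1}^M log(1 + τ⁻¹|λ*_j|) ) + C_Φ τ² ∑_{j=1}^M ‖φ_j‖²_{P_X,2} + β/(n+1), where C_Φ = 4·max_{|u| ≤ RL_φ} Φ″(u). -/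

import Mathlib

open MeasureTheory

/-- The one-dimensional unnormalised weight of the sparsity prior. -/
noncomputable def sparsityWeight (τ t : ℝ) : ℝ := ((τ ^ 2 + t ^ 2) ^ 2)⁻¹

section SparsityWeight

variable {τ : ℝ}

lemma sparsityWeight_pos (hτ : 0 < τ) (t : ℝ) : 0 < sparsityWeight τ t := by
  unfold sparsityWeight; positivity

lemma continuous_sparsityWeight (hτ : 0 < τ) : Continuous (sparsityWeight τ) := by
  unfold sparsityWeight
  exact Continuous.inv₀ (by fun_prop) fun t => by positivity

lemma integrable_inv_sq_add_sq (hτ : 0 < τ) :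
    Integrable fun t : ℝ => (τ ^ 2 + t ^ 2)⁻¹ := by
  have h := (integrable_inv_one_add_sq.comp_div hτ.ne').const_mul (τ ^ 2)⁻¹
  refine h.congr (Filter.Eventually.of_forall fun t => ?_)
  simp only
  rw [← mul_inv]
  congr 1
  field_simp

lemma integrable_sparsityWeight (hτ : 0 < τ) : Integrable (sparsityWeight τ) := by
  refine ((integrable_inv_sq_add_sq hτ).const_mul (τ ^ 2)⁻¹).mono'
    (continuous_sparsityWeight hτ).aestronglyMeasurable (Filter.Eventually.of_forall fun t => ?_)
  rw [Real.norm_of_nonneg (sparsityWeight_pos hτ t).le, sparsityWeight, ← mul_inv, sq (τ ^ 2 + _)]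
  gcongr
  nlinarith [sq_nonneg t]

lemma integrable_sq_mul_sparsityWeight (hτ : 0 < τ) :
    Integrable fun t => t ^ 2 * sparsityWeight τ t := by
  refine (integrable_inv_sq_add_sq hτ).mono'
    (((continuous_id.pow 2).mul (continuous_sparsityWeight hτ)).aestronglyMeasurable)
    (Filter.Eventually.of_forall fun t => ?_)
  rw [Real.norm_of_nonneg (mul_nonneg (sq_nonneg t) (sparsityWeight_pos hτ t).le), sparsityWeight]
  have : 0 < τ ^ 2 + t ^ 2 := by positivity
  rw [← div_eq_mul_inv, div_le_iff₀ (by positivity), sq (τ ^ 2 + _), inv_mul_cancel_left₀ this.ne']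
  nlinarith [sq_nonneg τ]

lemma integral_sparsityWeight_pos (hτ : 0 < τ) : 0 < ∫ t, sparsityWeight τ t := by
  refine (integral_pos_iff_support_of_nonneg (fun t => (sparsityWeight_pos hτ t).le)
    (integrable_sparsityWeight hτ)).2 ?_
  have : Function.support (sparsityWeight τ) = Set.univ :=
    Set.eq_univ_of_forall fun t => (sparsityWeight_pos hτ t).ne'
  simp [this]

lemma integral_sq_mul_sparsityWeight (hτ : 0 < τ) :
    ∫ t, t ^ 2 * sparsityWeight τ t = τ ^ 2 * ∫ t, sparsityWeight τ t := by
  have hd : ∀ t : ℝ, HasDerivAt (fun t : ℝ => t / (τ ^ 2 + t ^ 2))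
      (τ ^ 2 * sparsityWeight τ t - t ^ 2 * sparsityWeight τ t) t := fun t => by
    have h0 : τ ^ 2 + t ^ 2 ≠ 0 := by positivity
    have h := (hasDerivAt_id t).div ((hasDerivAt_pow 2 t).const_add (τ ^ 2)) h0
    refine h.congr_deriv ?_
    simp only [sparsityWeight, id]
    field_simp
    push_cast
    ring
  have hle : ∀ t : ℝ, |t / (τ ^ 2 + t ^ 2)| ≤ |t|⁻¹ := fun t => by
    rcases eq_or_ne t 0 with rfl | ht
    · simp
    have h1 : 0 < |t| := abs_pos.2 ht
    rw [abs_div, abs_of_pos (by positivity : 0 < τ ^ 2 + t ^ 2), div_le_iff₀ (by positivity),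
      ← sq_abs t, inv_mul_eq_div, le_div_iff₀ h1]
    nlinarith [sq_nonneg τ]
  have hinf : ∀ l : Filter ℝ, Filter.Tendsto (fun t : ℝ => |t|) l Filter.atTop →
      Filter.Tendsto (fun t : ℝ => t / (τ ^ 2 + t ^ 2)) l (nhds 0) := fun l hl =>
    squeeze_zero_norm hle (tendsto_inv_atTop_zero.comp hl)
  have hI := integral_of_hasDerivAt_of_tendsto hd
    (((integrable_sparsityWeight hτ).const_mul _).sub (integrable_sq_mul_sparsityWeight hτ))
    (hinf _ Filter.tendsto_abs_atBot_atTop) (hinf _ Filter.tendsto_abs_atTop_atTop)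
  rw [integral_sub ((integrable_sparsityWeight hτ).const_mul _)
    (integrable_sq_mul_sparsityWeight hτ), integral_const_mul] at hI
  linarith

lemma sparsityWeight_le_mul_sparsityWeight_add (hτ : 0 < τ) (a t : ℝ) :
    sparsityWeight τ t ≤ (1 + τ⁻¹ * |a|) ^ 4 * sparsityWeight τ (a + t) := by
  have h1 : 0 < τ ^ 2 + t ^ 2 := by positivity
  have h2 : 0 < τ ^ 2 + (a + t) ^ 2 := by positivity
  have key : τ ^ 2 + (a + t) ^ 2 ≤ (1 + τ⁻¹ * |a|) ^ 2 * (τ ^ 2 + t ^ 2) := by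
    obtain ⟨b, hb⟩ : ∃ b, b = τ⁻¹ * |a| := ⟨_, rfl⟩
    have hb0 : 0 ≤ b := by rw [hb]; positivity
    have hab : |a| = τ * b := by rw [hb]; field_simp
    rw [← hb]
    have h3 : a * t ≤ τ * b * |t| := by
      rw [← hab, ← abs_mul]; exact le_abs_self _
    have h4 : a ^ 2 = τ ^ 2 * b ^ 2 := by rw [← sq_abs, hab]; ring
    have h5 : t ^ 2 = |t| ^ 2 := (sq_abs t).symm
    have e : (a + t) ^ 2 = a ^ 2 + 2 * (a * t) + t ^ 2 := by ring
    rw [e, h4, h5]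
    nlinarith [mul_nonneg hb0 (sq_nonneg (τ - |t|)), mul_nonneg (sq_nonneg b) (sq_nonneg |t|)]
  unfold sparsityWeight
  rw [← div_eq_mul_inv, le_div_iff₀ (by positivity), inv_mul_le_iff₀ (by positivity)]
  calc (τ ^ 2 + (a + t) ^ 2) ^ 2 ≤ ((1 + τ⁻¹ * |a|) ^ 2 * (τ ^ 2 + t ^ 2)) ^ 2 := by gcongr
    _ = _ := by ring

variable {ι : Type*} [Fintype ι]

lemma integrable_prod_sparsityWeight (hτ : 0 < τ) :
    Integrable fun t : ι → ℝ => ∏ i, sparsityWeight τ (t i) :=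
  Integrable.fintype_prod (μ := fun _ : ι => (volume : Measure ℝ))
    fun _ => integrable_sparsityWeight hτ

lemma sq_mul_prod_sparsityWeight [DecidableEq ι] (j : ι) (t : ι → ℝ) :
    t j ^ 2 * ∏ i, sparsityWeight τ (t i) =
      ∏ i, (if i = j then fun s => s ^ 2 * sparsityWeight τ s else sparsityWeight τ) (t i) := by
  rw [← Finset.mul_prod_erase _ _ (Finset.mem_univ j),
    ← Finset.mul_prod_erase Finset.univ (fun i => (if i = j then _ else _ : ℝ → ℝ) (t i))
      (Finset.mem_univ j), if_pos rfl, mul_assoc]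
  congr 2
  exact Finset.prod_congr rfl fun i hi => by rw [if_neg (Finset.ne_of_mem_erase hi)]

lemma integrable_sq_mul_prod_sparsityWeight (hτ : 0 < τ) (j : ι) :
    Integrable fun t : ι → ℝ => t j ^ 2 * ∏ i, sparsityWeight τ (t i) := by
  classical
  simp_rw [sq_mul_prod_sparsityWeight]
  refine Integrable.fintype_prod (μ := fun _ : ι => (volume : Measure ℝ)) fun i => ?_
  split_ifs
  exacts [integrable_sq_mul_sparsityWeight hτ, integrable_sparsityWeight hτ]

lemma integral_sq_mul_prod_sparsityWeight (hτ : 0 < τ) (j : ι) :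
    ∫ t : ι → ℝ, t j ^ 2 * ∏ i, sparsityWeight τ (t i) =
      τ ^ 2 * ∫ t : ι → ℝ, ∏ i, sparsityWeight τ (t i) := by
  classical
  simp_rw [sq_mul_prod_sparsityWeight]
  rw [integral_fintype_prod_volume_eq_prod, integral_fintype_prod_volume_eq_prod,
    ← Finset.mul_prod_erase _ _ (Finset.mem_univ j),
    ← Finset.mul_prod_erase Finset.univ (fun _ => ∫ t, sparsityWeight τ t) (Finset.mem_univ j),
    if_pos rfl, integral_sq_mul_sparsityWeight hτ, mul_assoc]
  congr 2
  exact Finset.prod_congr rfl fun i hi => by rw [if_neg (Finset.ne_of_mem_erase hi)]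

/-- At least half of the mass of the product weight lies in the `ℓ¹`-ball of radius `2Mτ`. -/
lemma half_le_setIntegral_prod_sparsityWeight [Nonempty ι] (hτ : 0 < τ) :
    (∫ t : ι → ℝ, ∏ i, sparsityWeight τ (t i)) / 2 ≤
      ∫ t in {t : ι → ℝ | ∑ i, |t i| ≤ 2 * Fintype.card ι * τ}, ∏ i, sparsityWeight τ (t i) := by
  set B : Set (ι → ℝ) := {t | ∑ i, |t i| ≤ 2 * Fintype.card ι * τ}
  have hB : MeasurableSet B := measurableSet_le (by fun_prop) measurable_const
  have hN : (0 : ℝ) < Fintype.card ι := by exact_mod_cast Fintype.card_pos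
  set N : ℝ := (Fintype.card ι : ℝ)
  have hH : Integrable fun t : ι → ℝ => ∏ i, sparsityWeight τ (t i) :=
    integrable_prod_sparsityWeight hτ
  have hnn : ∀ t : ι → ℝ, 0 ≤ ∏ i, sparsityWeight τ (t i) := fun t =>
    Finset.prod_nonneg fun i _ => (sparsityWeight_pos hτ _).le
  have hsq := fun j : ι => integrable_sq_mul_prod_sparsityWeight hτ j
  have hG : Integrable fun t : ι → ℝ => (4 * N * τ ^ 2)⁻¹ *
      ∑ j, (τ ^ 2 * ∏ i, sparsityWeight τ (t i) + t j ^ 2 * ∏ i, sparsityWeight τ (t i)) :=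
    (integrable_finsetSum _ fun j _ => (hH.const_mul _).add (hsq j)).const_mul _
  have hGI : ∫ t : ι → ℝ, (4 * N * τ ^ 2)⁻¹ *
      ∑ j, (τ ^ 2 * ∏ i, sparsityWeight τ (t i) + t j ^ 2 * ∏ i, sparsityWeight τ (t i)) =
      (∫ t : ι → ℝ, ∏ i, sparsityWeight τ (t i)) / 2 := by
    have hadd : ∀ j ∈ Finset.univ, Integrable fun t : ι → ℝ =>
        τ ^ 2 * ∏ i, sparsityWeight τ (t i) + t j ^ 2 * ∏ i, sparsityWeight τ (t i) :=
      fun j _ => (hH.const_mul _).add (hsq j)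
    rw [integral_const_mul, integral_finsetSum _ hadd]
    simp_rw [fun j : ι => integral_add (hH.const_mul (τ ^ 2)) (hsq j),
      integral_sq_mul_prod_sparsityWeight hτ, integral_const_mul]
    rw [Finset.sum_const, Finset.card_univ, nsmul_eq_mul]
    field_simp
    ring
  have hcompl : ∫ t in Bᶜ, ∏ i, sparsityWeight τ (t i) ≤
      (∫ t : ι → ℝ, ∏ i, sparsityWeight τ (t i)) / 2 := by
    rw [← hGI]
    refine (setIntegral_mono_on hH.integrableOn hG.integrableOn hB.compl fun t ht => ?_).trans
      (setIntegral_le_integral hG (Filter.Eventually.of_forall fun t => ?_))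
    · have ht' : 2 * N * τ < ∑ i, |t i| := not_le.1 ht
      simp_rw [← add_mul]
      rw [← Finset.sum_mul, ← mul_assoc]
      refine le_mul_of_one_le_left (hnn t) ?_
      rw [inv_mul_eq_div, one_le_div (by positivity)]
      have : ∑ i, 2 * τ * |t i| ≤ ∑ i, (τ ^ 2 + t i ^ 2) := Finset.sum_le_sum fun i _ => by
        nlinarith [sq_nonneg (τ - |t i|), sq_abs (t i)]
      rw [← Finset.mul_sum] at this
      nlinarith
    · have := hnn t
      simp only [Pi.zero_apply]
      exact mul_nonneg (by positivity) (Finset.sum_nonneg fun j _ => by positivity)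
  have := integral_add_compl hB hH
  linarith

/-- The coordinate reflection `t ↦ (t₁, …, -tⱼ, …, t_M)`. -/
def reflectCoord [DecidableEq ι] (j : ι) : (ι → ℝ) ≃ᵐ (ι → ℝ) :=
  MeasurableEquiv.piCongrRight fun i => if i = j then MeasurableEquiv.neg ℝ else .refl ℝ

lemma reflectCoord_apply {κ : Type*} [DecidableEq κ] (j : κ) (t : κ → ℝ) (i : κ) :
    reflectCoord j t i = if i = j then -t i else t i := by
  change (if i = j then MeasurableEquiv.neg ℝ else .refl ℝ : ℝ ≃ᵐ ℝ) (t i) = _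
  split_ifs <;> rfl

lemma measurePreserving_reflectCoord [DecidableEq ι] (j : ι) :
    MeasurePreserving (reflectCoord j : (ι → ℝ) → ι → ℝ) := by
  refine volume_preserving_pi (f := fun i => ((if i = j then MeasurableEquiv.neg ℝ else .refl ℝ :
    ℝ ≃ᵐ ℝ) : ℝ → ℝ)) fun i => ?_
  split_ifs
  exacts [Measure.measurePreserving_neg volume, MeasurePreserving.id _]

/-- A symmetric probability density, dominated by the product weight, with support in the
`ℓ¹`-ball of radius `2Mτ` and second moments at most `2τ²`. -/
lemma exists_symmetric_density [Nonempty ι] (hτ : 0 < τ) :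
    ∃ g : (ι → ℝ) → ℝ, Measurable g ∧ (∀ t, 0 ≤ g t) ∧ Integrable g ∧ ∫ t, g t = 1 ∧
      (∀ t, g t ≤ 2 / (∫ t : ι → ℝ, ∏ i, sparsityWeight τ (t i)) * ∏ i, sparsityWeight τ (t i)) ∧
      (∀ t, g t ≠ 0 → ∑ i, |t i| ≤ 2 * Fintype.card ι * τ) ∧
      (∀ j, ∫ t, g t * t j = 0) ∧ (∀ i j, i ≠ j → ∫ t, g t * (t i * t j) = 0) ∧
      ∀ j, ∫ t, g t * t j ^ 2 ≤ 2 * τ ^ 2 := by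
  classical
  set B : Set (ι → ℝ) := {t | ∑ i, |t i| ≤ 2 * Fintype.card ι * τ}
  have hB : MeasurableSet B := measurableSet_le (by fun_prop) measurable_const
  have hH : Integrable fun t : ι → ℝ => ∏ i, sparsityWeight τ (t i) :=
    integrable_prod_sparsityWeight hτ
  have hHm : Measurable fun t : ι → ℝ => ∏ i, sparsityWeight τ (t i) :=
    Finset.measurable_prod _ fun i _ =>
      (continuous_sparsityWeight hτ).measurable.comp (measurable_pi_apply i)
  have hnn : ∀ t : ι → ℝ, 0 ≤ ∏ i, sparsityWeight τ (t i) := fun t =>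
    Finset.prod_nonneg fun i _ => (sparsityWeight_pos hτ _).le
  have hI : 0 < ∫ t : ι → ℝ, ∏ i, sparsityWeight τ (t i) := by
    rw [integral_fintype_prod_volume_eq_prod]
    exact Finset.prod_pos fun _ _ => integral_sparsityWeight_pos hτ
  have hZ := half_le_setIntegral_prod_sparsityWeight (ι := ι) hτ
  change _ ≤ ∫ t in B, _ at hZ
  set I := ∫ t : ι → ℝ, ∏ i, sparsityWeight τ (t i)
  set Z := ∫ t in B, ∏ i, sparsityWeight τ (t i)
  have hZ0 : 0 < Z := by linarith
  have hZi : Z⁻¹ ≤ 2 / I := by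
    rw [inv_eq_one_div, div_le_div_iff₀ hZ0 hI]; linarith
  set g : (ι → ℝ) → ℝ := B.indicator fun t => Z⁻¹ * ∏ i, sparsityWeight τ (t i) with hg
  have hg0 : ∀ t, 0 ≤ g t := Set.indicator_nonneg fun t _ => mul_nonneg (by positivity) (hnn t)
  have hgle : ∀ t, g t ≤ Z⁻¹ * ∏ i, sparsityWeight τ (t i) := fun t =>
    Set.indicator_le_self' (fun _ _ => mul_nonneg (by positivity) (hnn t)) t
  have hgr : ∀ (j : ι) (t : ι → ℝ), g (reflectCoord j t) = g t := fun j t => by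
    have hw : ∀ i, sparsityWeight τ (reflectCoord j t i) = sparsityWeight τ (t i) := fun i => by
      rw [reflectCoord_apply]; split_ifs <;> simp [sparsityWeight]
    have ha : ∀ i, |reflectCoord j t i| = |t i| := fun i => by
      rw [reflectCoord_apply]; split_ifs <;> simp
    simp only [hg, Set.indicator, B, Set.mem_ofPred_eq, hw, ha]
  have hodd : ∀ (j : ι) (F : (ι → ℝ) → ℝ), (∀ t, F (reflectCoord j t) = -F t) →
      ∫ t, g t * F t = 0 := fun j F hF => by
    have h := (measurePreserving_reflectCoord j).integral_comp' fun t => g t * F t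
    simp_rw [hgr, hF, mul_neg, integral_neg] at h
    linarith
  refine ⟨g, (hHm.const_mul _).indicator hB, hg0, (hH.const_mul _).indicator hB, ?_, fun t =>
    (hgle t).trans (mul_le_mul_of_nonneg_right hZi (hnn t)), fun t ht => ?_, fun j => ?_,
    fun i j hij => ?_, fun j => ?_⟩
  · rw [hg, integral_indicator hB, integral_const_mul]
    exact inv_mul_cancel₀ hZ0.ne'
  · by_contra h
    exact ht (Set.indicator_of_notMem (show t ∉ B from h) _)
  · exact hodd j _ fun t => by simp [reflectCoord_apply]
  · exact hodd j _ fun t => by simp [reflectCoord_apply, hij]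
  · calc ∫ t, g t * t j ^ 2 ≤ ∫ t : ι → ℝ, 2 / I * (t j ^ 2 * ∏ i, sparsityWeight τ (t i)) := by
          refine integral_mono_of_nonneg (Filter.Eventually.of_forall fun t =>
            mul_nonneg (hg0 t) (sq_nonneg _))
            ((integrable_sq_mul_prod_sparsityWeight hτ j).const_mul _)
            (Filter.Eventually.of_forall fun t => ?_)
          have := mul_le_mul_of_nonneg_right
            ((hgle t).trans (mul_le_mul_of_nonneg_right hZi (hnn t))) (sq_nonneg (t j))
          simp only
          linarith
      _ = 2 * τ ^ 2 := by
          rw [integral_const_mul, integral_sq_mul_prod_sparsityWeight hτ]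
          change 2 / I * (τ ^ 2 * I) = _
          field_simp

end SparsityWeight

section Perturbation

variable {M : ℕ} {τ R c : ℝ} {π : Measure (Fin M → ℝ)}

/-- The sparsity prior dominates, up to the factor `2 ∏ⱼ (1 + |λ*ⱼ|/τ)⁴`, a probability measure
that is centred at `λ*` with uncorrelated coordinates of variance at most `2τ²`. -/
lemma exists_centered_le_smul_sparsityPrior (hM : 0 < M) (hτ : 0 < τ) (hc : 0 < c)
    (hπ : π = volume.withDensity fun l => ENNReal.ofReal
      (if (∑ j, |l j|) ≤ R then c * ∏ j, ((τ ^ 2 + l j ^ 2) ^ 2)⁻¹ else 0))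
    (hπprob : IsProbabilityMeasure π) (a : Fin M → ℝ) (ha : ∑ j, |a j| ≤ R - 2 * M * τ) :
    ∃ ρ : Measure (Fin M → ℝ), IsProbabilityMeasure ρ ∧
      ρ ≤ ENNReal.ofReal (2 * ∏ j, (1 + τ⁻¹ * |a j|) ^ 4) • π ∧
      (∀ᵐ l ∂ρ, ∑ j, |l j| ≤ R) ∧ (∀ j, ∫ l, (l j - a j) ∂ρ = 0) ∧
      (∀ i j, i ≠ j → ∫ l, (l i - a i) * (l j - a j) ∂ρ = 0) ∧
      ∀ j, ∫ l, (l j - a j) ^ 2 ∂ρ ≤ 2 * τ ^ 2 := by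
  have : Nonempty (Fin M) := ⟨⟨0, hM⟩⟩
  obtain ⟨g, hgm, hg0, hgi, hg1, hgle, hgs, hm1, hm2, hm3⟩ :=
    exists_symmetric_density (ι := Fin M) hτ
  have hH : Integrable fun t : Fin M → ℝ => ∏ i, sparsityWeight τ (t i) :=
    integrable_prod_sparsityWeight hτ
  have hHm : Measurable fun t : Fin M → ℝ => ∏ i, sparsityWeight τ (t i) :=
    Finset.measurable_prod _ fun i _ =>
      (continuous_sparsityWeight hτ).measurable.comp (measurable_pi_apply i)
  have hnn : ∀ t : Fin M → ℝ, 0 ≤ ∏ i, sparsityWeight τ (t i) := fun t =>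
    Finset.prod_nonneg fun i _ => (sparsityWeight_pos hτ _).le
  have hI : 0 < ∫ t : Fin M → ℝ, ∏ i, sparsityWeight τ (t i) := by
    rw [integral_fintype_prod_volume_eq_prod]
    exact Finset.prod_pos fun _ _ => integral_sparsityWeight_pos hτ
  set d : (Fin M → ℝ) → ℝ := fun l =>
    if (∑ j, |l j|) ≤ R then c * ∏ j, sparsityWeight τ (l j) else 0 with hd
  have hπ' : π = volume.withDensity fun l => ENNReal.ofReal (d l) := hπ
  have hdm : Measurable d := Measurable.ite (measurableSet_le (by fun_prop) measurable_const)
    (hHm.const_mul c) measurable_const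
  have hcI : (∫ t : Fin M → ℝ, ∏ i, sparsityWeight τ (t i))⁻¹ ≤ c := by
    have h1 : (1 : ENNReal) ≤ ENNReal.ofReal
        (c * ∫ t : Fin M → ℝ, ∏ i, sparsityWeight τ (t i)) := by
      rw [← hπprob.measure_univ, hπ', withDensity_apply _ MeasurableSet.univ,
        Measure.restrict_univ, ← integral_const_mul, ofReal_integral_eq_lintegral_ofReal
          (hH.const_mul c) (Filter.Eventually.of_forall fun t => mul_nonneg hc.le (hnn t))]
      refine lintegral_mono fun t => ENNReal.ofReal_le_ofReal ?_
      simp only [hd]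
      split_ifs
      exacts [le_rfl, mul_nonneg hc.le (hnn t)]
    rw [ENNReal.one_le_ofReal] at h1
    rwa [inv_le_iff_one_le_mul₀ hI]
  set ν : Measure (Fin M → ℝ) := volume.withDensity fun t => ENNReal.ofReal (g t) with hν
  have : IsProbabilityMeasure ν := ⟨by
    rw [hν, withDensity_apply _ MeasurableSet.univ, Measure.restrict_univ,
      ← ofReal_integral_eq_lintegral_ofReal hgi (Filter.Eventually.of_forall hg0), hg1,
      ENNReal.ofReal_one]⟩
  have hνint : ∀ F : (Fin M → ℝ) → ℝ, ∫ t, F t ∂ν = ∫ t, g t * F t := fun F => by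
    rw [hν, integral_withDensity_eq_integral_toReal_smul hgm.ennreal_ofReal
      (Filter.Eventually.of_forall fun t => ENNReal.ofReal_lt_top)]
    simp only [ENNReal.toReal_ofReal (hg0 _), smul_eq_mul]
  have hmap : ∀ F : (Fin M → ℝ) → ℝ,
      ∫ l, F l ∂(ν.map (MeasurableEquiv.addLeft a)) = ∫ t, g t * F (a + t) := fun F => by
    rw [integral_map_equiv, hνint]; rfl
  have hpt : ∀ t, g t ≤ (2 * ∏ j, (1 + τ⁻¹ * |a j|) ^ 4) * d (a + t) := fun t => by
    by_cases ht : g t = 0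
    · rw [ht]
      refine mul_nonneg (mul_nonneg two_pos.le (Finset.prod_nonneg fun j _ => by positivity)) ?_
      simp only [hd]
      split_ifs
      exacts [mul_nonneg hc.le (hnn _), le_rfl]
    have h1 := hgs t ht
    rw [Fintype.card_fin] at h1
    have h2 : ∑ j, |(a + t) j| ≤ R := by
      calc ∑ j, |(a + t) j| ≤ ∑ j, (|a j| + |t j|) :=
            Finset.sum_le_sum fun j _ => abs_add_le _ _
        _ ≤ R := by rw [Finset.sum_add_distrib]; linarith
    simp only [hd, if_pos h2]
    refine (hgle t).trans ?_
    calc _ ≤ 2 * c * ∏ j, ((1 + τ⁻¹ * |a j|) ^ 4 * sparsityWeight τ (a j + t j)) := by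
          refine mul_le_mul ?_ (Finset.prod_le_prod (fun j _ => (sparsityWeight_pos hτ _).le)
            fun j _ => sparsityWeight_le_mul_sparsityWeight_add hτ _ _) (hnn t) (by positivity)
          rw [div_eq_mul_inv]
          linarith
      _ = _ := by rw [Finset.prod_mul_distrib]; simp only [Pi.add_apply]; ring
  refine ⟨ν.map (MeasurableEquiv.addLeft a),
    Measure.isProbabilityMeasure_map (MeasurableEquiv.measurable _).aemeasurable, ?_, ?_,
    fun j => ?_, fun i j hij => ?_, fun j => ?_⟩
  · refine Measure.le_iff.2 fun s hs => ?_
    rw [MeasurableEquiv.map_apply, hν, withDensity_apply _ (MeasurableEquiv.measurable _ hs),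
      Measure.smul_apply, hπ', withDensity_apply _ hs, smul_eq_mul,
      ← lintegral_const_mul _ hdm.ennreal_ofReal,
      ← (measurePreserving_add_left volume a).setLIntegral_comp_preimage hs
        (hdm.ennreal_ofReal.const_mul _)]
    refine lintegral_mono fun t => ?_
    rw [← ENNReal.ofReal_mul (mul_nonneg two_pos.le (Finset.prod_nonneg fun j _ => by positivity))]
    exact ENNReal.ofReal_le_ofReal (hpt t)
  · rw [(MeasurableEquiv.addLeft a).measurableEmbedding.ae_map_iff, hν,
      ae_withDensity_iff hgm.ennreal_ofReal]
    refine Filter.Eventually.of_forall fun t ht => ?_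
    have h1 := hgs t fun h => ht (by rw [h, ENNReal.ofReal_zero])
    rw [Fintype.card_fin] at h1
    calc ∑ j, |(a + t) j| ≤ ∑ j, (|a j| + |t j|) :=
          Finset.sum_le_sum fun j _ => abs_add_le _ _
      _ ≤ R := by rw [Finset.sum_add_distrib]; linarith
  · rw [hmap]
    simpa using hm1 j
  · rw [hmap fun l => (l i - a i) * (l j - a j)]
    simpa using hm2 i j hij
  · rw [hmap fun l => (l j - a j) ^ 2]
    simpa using hm3 j

end Perturbation

lemma concaveOn_exp_neg_div {Φ : ℝ → ℝ} (hΦ : ContDiff ℝ 2 Φ) {β r : ℝ} (hβ : 0 < β)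
    (h : ∀ u, |u| ≤ r → deriv Φ u ^ 2 ≤ β * deriv (deriv Φ) u) :
    ConcaveOn ℝ (Set.Icc (-r) r) fun u => Real.exp (-Φ u / β) := by
  have hd : ∀ u, HasDerivAt Φ (deriv Φ u) u := fun u =>
    (hΦ.differentiable (by norm_num)).differentiableAt.hasDerivAt
  have hd2 : ∀ u, HasDerivAt (deriv Φ) (deriv (deriv Φ) u) u := fun u =>
    ((hΦ.deriv' (n := 1)).differentiable (by norm_num)).differentiableAt.hasDerivAt
  have h1 : ∀ u, HasDerivAt (fun u => Real.exp (-Φ u / β))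
      (Real.exp (-Φ u / β) * (-deriv Φ u / β)) u := fun u => ((hd u).neg.div_const β).exp
  have h1' : deriv (fun u => Real.exp (-Φ u / β)) =
      fun u => Real.exp (-Φ u / β) * (-deriv Φ u / β) := funext fun u => (h1 u).deriv
  have h2 : ∀ u, HasDerivAt (fun u => Real.exp (-Φ u / β) * (-deriv Φ u / β))
      (Real.exp (-Φ u / β) * (-deriv Φ u / β) * (-deriv Φ u / β) +
        Real.exp (-Φ u / β) * (-deriv (deriv Φ) u / β)) u := fun u =>
    (h1 u).mul ((hd2 u).neg.div_const β)
  refine concaveOn_of_deriv2_nonpos (convex_Icc _ _)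
    (fun u _ => (h1 u).continuousAt.continuousWithinAt)
    (fun u _ => (h1 u).differentiableAt.differentiableWithinAt) ?_ fun u hu => ?_
  · rw [h1']
    exact fun u _ => (h2 u).differentiableAt.differentiableWithinAt
  · rw [interior_Icc] at hu
    simp only [Function.iterate_succ, Function.iterate_zero, Function.comp_apply, id]
    rw [h1', (h2 u).deriv, mul_assoc, ← mul_add]
    refine mul_nonpos_of_nonneg_of_nonpos (Real.exp_pos _).le ?_
    have := h u (abs_le.2 ⟨hu.1.le, hu.2.le⟩)
    have e : -deriv Φ u / β * (-deriv Φ u / β) + -deriv (deriv Φ) u / β =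
        (deriv Φ u ^ 2 - β * deriv (deriv Φ) u) / β ^ 2 := by
      field_simp
      ring
    rw [e]
    exact div_nonpos_of_nonpos_of_nonneg (by linarith) (by positivity)

section Gibbs

variable {Λ : Type*} [MeasurableSpace Λ] {π : Measure Λ} [IsProbabilityMeasure π] {β : ℝ}

lemma integrable_of_measurable_of_abs_le {f : Λ → ℝ} (hf : Measurable f) {D : ℝ}
    (hD : ∀ l, |f l| ≤ D) : Integrable f π :=
  Integrable.of_bound hf.aestronglyMeasurable D (Filter.Eventually.of_forall hD)

lemma abs_integral_le_of_abs_le {f : Λ → ℝ} {D : ℝ} (hD : ∀ l, |f l| ≤ D) :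
    |∫ l, f l ∂π| ≤ D := by
  have h := norm_integral_le_of_norm_le_const (μ := π) (f := f) (Filter.Eventually.of_forall hD)
  rwa [probReal_univ, mul_one] at h

lemma neg_div_mem_Icc (hβ : 0 < β) {s D : ℝ} (h : |s| ≤ D) :
    -s / β ∈ Set.Icc (-(D / β)) (D / β) := by
  rw [Set.mem_Icc, ← abs_le, abs_div, abs_neg, abs_of_pos hβ]
  gcongr

lemma integrable_exp_neg_div (hβ : 0 < β) {S : Λ → ℝ} (hS : Measurable S) {D : ℝ}
    (hD : ∀ l, |S l| ≤ D) : Integrable (fun l => Real.exp (-S l / β)) π :=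
  integrable_of_measurable_of_abs_le (by fun_prop) fun l => by
    rw [Real.abs_exp]
    exact Real.exp_le_exp.2 (neg_div_mem_Icc hβ (hD l)).2

lemma integral_exp_neg_div_pos (hβ : 0 < β) {S : Λ → ℝ} (hS : Measurable S) {D : ℝ}
    (hD : ∀ l, |S l| ≤ D) : 0 < ∫ l, Real.exp (-S l / β) ∂π :=
  integral_exp_pos (integrable_exp_neg_div hβ hS hD)

lemma abs_log_integral_exp_neg_div_le (hβ : 0 < β) {S : Λ → ℝ} (hS : Measurable S) {D : ℝ}
    (hD : ∀ l, |S l| ≤ D) : |Real.log (∫ l, Real.exp (-S l / β) ∂π)| ≤ D / β := by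
  have hi := integrable_exp_neg_div (π := π) hβ hS hD
  have hpos := integral_exp_neg_div_pos (π := π) hβ hS hD
  rw [abs_le, Real.le_log_iff_exp_le hpos, Real.log_le_iff_le_exp hpos]
  constructor
  · simpa using integral_mono (integrable_const (Real.exp (-(D / β)))) hi
      fun l => Real.exp_le_exp.2 (neg_div_mem_Icc hβ (hD l)).1
  · simpa using integral_mono hi (integrable_const (Real.exp (D / β)))
      fun l => Real.exp_le_exp.2 (neg_div_mem_Icc hβ (hD l)).2

/-- Gibbs means stay in the range of the averaged function, and the loss of a Gibbs mean is
controlled by a ratio of partition functions when the loss is exp-concave. -/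
lemma gibbs_mean_bounds (hβ : 0 < β) {S u : Λ → ℝ} (hS : Measurable S) (hu : Measurable u)
    {D r : ℝ} (hD : ∀ l, |S l| ≤ D) (hr : ∀ l, |u l| ≤ r) {Φ : ℝ → ℝ} (hΦ : Continuous Φ)
    (hconc : ConcaveOn ℝ (Set.Icc (-r) r) fun v => Real.exp (-Φ v / β)) :
    |∫ l, Real.exp (-S l / β) / (∫ w, Real.exp (-S w / β) ∂π) * u l ∂π| ≤ r ∧
    Φ (∫ l, Real.exp (-S l / β) / (∫ w, Real.exp (-S w / β) ∂π) * u l ∂π) ≤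
      -β * (Real.log (∫ l, Real.exp (-(S l + Φ (u l)) / β) ∂π) -
        Real.log (∫ l, Real.exp (-S l / β) ∂π)) := by
  have hi := integrable_exp_neg_div (π := π) hβ hS hD
  have hpos := integral_exp_neg_div_pos (π := π) hβ hS hD
  have := isProbabilityMeasure_tilted hi
  have hmean : ∀ F : Λ → ℝ, ∫ l, F l ∂(π.tilted fun l => -S l / β) =
      ∫ l, Real.exp (-S l / β) / (∫ w, Real.exp (-S w / β) ∂π) * F l ∂π := fun F => by
    rw [integral_tilted]; rfl
  have hmem : ∀ l, u l ∈ Set.Icc (-r) r := fun l => abs_le.1 (hr l)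
  obtain ⟨B, hB⟩ := isCompact_Icc.exists_bound_of_continuousOn (hΦ.continuousOn (s := Set.Icc (-r) r))
  have hui : Integrable u (π.tilted fun l => -S l / β) := integrable_of_measurable_of_abs_le hu hr
  have hΦu : Measurable fun l => Φ (u l) := hΦ.measurable.comp hu
  have hΦB : ∀ l, |Φ (u l)| ≤ B := fun l => hB _ (hmem l)
  have hJ := hconc.le_map_integral (by fun_prop) isClosed_Icc
    (Filter.Eventually.of_forall hmem) hui (integrable_exp_neg_div hβ hΦu hΦB)
  rw [hmean, hmean u] at hJ
  constructor
  · rw [← hmean]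
    exact abs_integral_le_of_abs_le hr
  · set m := ∫ l, Real.exp (-S l / β) / (∫ w, Real.exp (-S w / β) ∂π) * u l ∂π
    have hpos2 : 0 < ∫ l, Real.exp (-(S l + Φ (u l)) / β) ∂π :=
      integral_exp_neg_div_pos hβ (hS.add hΦu) fun l =>
        (abs_add_le _ _).trans (add_le_add (hD l) (hΦB l))
    have e : ∫ l, Real.exp (-S l / β) / (∫ w, Real.exp (-S w / β) ∂π) * Real.exp (-Φ (u l) / β) ∂π =
        (∫ l, Real.exp (-(S l + Φ (u l)) / β) ∂π) / ∫ w, Real.exp (-S w / β) ∂π := by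
      rw [← integral_div]
      congr 1 with l
      rw [neg_add, add_div, Real.exp_add]
      ring
    rw [e, ← Real.log_le_iff_le_exp (div_pos hpos2 hpos), Real.log_div hpos2.ne' hpos.ne',
      le_div_iff₀ hβ] at hJ
    linarith

/-- A one-sided Donsker–Varadhan bound for a measure dominated by a multiple of the reference. -/
lemma neg_mul_log_integral_exp_le {ρ : Measure Λ} [IsProbabilityMeasure ρ] {K : ℝ} (hK : 0 < K)
    (hρ : ρ ≤ ENNReal.ofReal K • π) (hβ : 0 < β) {S : Λ → ℝ} (hS : Measurable S) {D : ℝ}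
    (hD : ∀ l, |S l| ≤ D) :
    -β * Real.log (∫ l, Real.exp (-S l / β) ∂π) ≤ ∫ l, S l ∂ρ + β * Real.log K := by
  have hpos := integral_exp_neg_div_pos (π := π) hβ hS hD
  have hi : Integrable (fun l => -S l / β) ρ :=
    ((integrable_of_measurable_of_abs_le hS hD).neg).div_const β
  have h1 : Real.exp (∫ l, -S l / β ∂ρ) ≤ ∫ l, Real.exp (-S l / β) ∂ρ :=
    convexOn_exp.map_integral_le Real.continuous_exp.continuousOn isClosed_univ
      (Filter.Eventually.of_forall fun _ => Set.mem_univ _) hi (integrable_exp_neg_div hβ hS hD)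
  have h2 : ∫ l, Real.exp (-S l / β) ∂ρ ≤ K * ∫ l, Real.exp (-S l / β) ∂π := by
    have h := integral_mono_measure hρ
      (Filter.Eventually.of_forall fun l => (Real.exp_pos (-S l / β)).le)
      ((integrable_exp_neg_div hβ hS hD).smul_measure ENNReal.ofReal_ne_top)
    rwa [integral_smul_measure, ENNReal.toReal_ofReal hK.le, smul_eq_mul] at h
  have h3 := (Real.le_log_iff_exp_le (mul_pos hK hpos)).2 (h1.trans h2)
  rw [Real.log_mul hK.ne' hpos.ne', integral_div, integral_neg, div_le_iff₀ hβ] at h3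
  linarith

end Gibbs

section LogPartition

lemma abs_sum_loss_le {Z Λ ι : Type*} {B : ℝ} {q : Z → Λ → ℝ} (hqB : ∀ z l, |q z l| ≤ B) (s : Finset ι) (ζ : ι → Z) (l : Λ) :
    |∑ i ∈ s, q (ζ i) l| ≤ s.card * B :=
  (Finset.abs_sum_le_sum_abs _ _).trans <|
    (Finset.sum_le_sum fun i _ => hqB (ζ i) l).trans (by simp)

variable {Z Λ ι : Type*} [MeasurableSpace Z] [MeasurableSpace Λ]

/-- The logarithm of the partition function of the losses of the observations indexed by `s`. -/
noncomputable def logPartition (π : Measure Λ) (β : ℝ) (q : Z → Λ → ℝ) (s : Finset ι)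
    (ζ : ι → Z) : ℝ :=
  Real.log (∫ l, Real.exp (-(∑ i ∈ s, q (ζ i) l) / β) ∂π)

variable {P : Measure Z} [IsProbabilityMeasure P] {π : Measure Λ}
  {β B : ℝ} {q : Z → Λ → ℝ}

lemma measurable_loss (hq : Measurable (Function.uncurry q)) (z : Z) : Measurable (q z) :=
  hq.comp (measurable_const.prodMk measurable_id)

lemma measurable_sum_loss (hq : Measurable (Function.uncurry q)) (s : Finset ι) (ζ : ι → Z) :
    Measurable fun l => ∑ i ∈ s, q (ζ i) l :=
  Finset.measurable_fun_sum _ fun i _ => measurable_loss hq (ζ i)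

variable [Fintype ι]

/-- The observations are exchangeable. -/
lemma integral_logPartition_map (s : Finset ι) (σ : Equiv.Perm ι) :
    ∫ ζ, logPartition π β q (s.map σ.toEmbedding) ζ ∂(Measure.pi fun _ : ι => P) =
      ∫ ζ, logPartition π β q s ζ ∂(Measure.pi fun _ : ι => P) := by
  rw [← (measurePreserving_piCongrLeft (fun _ : ι => P) σ).integral_comp']
  congr 1 with ζ
  simp only [logPartition, Finset.sum_map, Equiv.coe_toEmbedding]
  congr 3 with l
  congr 4 with i
  exact congrArg (q · l) (Equiv.piCongrLeft_apply_apply (fun _ => Z) σ ζ i)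

variable [IsProbabilityMeasure π]

lemma integrable_logPartition (hβ : 0 < β) (hq : Measurable (Function.uncurry q))
    (hqB : ∀ z l, |q z l| ≤ B) (s : Finset ι) :
    Integrable (logPartition π β q s) (Measure.pi fun _ : ι => P) := by
  refine integrable_of_measurable_of_abs_le (Real.measurable_log.comp ?_) fun ζ =>
    abs_log_integral_exp_neg_div_le hβ (measurable_sum_loss hq s ζ) (abs_sum_loss_le hqB s ζ)
  refine (StronglyMeasurable.integral_prod_right (f := fun (ζ : ι → Z) (l : Λ) =>
    Real.exp (-(∑ i ∈ s, q (ζ i) l) / β)) (Measurable.stronglyMeasurable ?_)).measurable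
  have h : Measurable fun p : (ι → Z) × Λ => ∑ i ∈ s, q (p.1 i) p.2 :=
    Finset.measurable_fun_sum _ fun i _ => by
      have hi : Measurable fun p : (ι → Z) × Λ => (p.1 i, p.2) := by fun_prop
      exact hq.comp hi
  exact (h.neg.div_const β).exp

lemma map_swap_insert_last {n m : ℕ} (hm : m < n + 1) :
    (insert (Fin.last n) (Finset.univ.filter fun i : Fin (n + 1) => (i : ℕ) < m)).map
      (Equiv.swap ⟨m, hm⟩ (Fin.last n)).toEmbedding =
      Finset.univ.filter fun i : Fin (n + 1) => (i : ℕ) < m + 1 := by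
  ext i
  simp only [Finset.mem_map_equiv, Equiv.symm_swap, Finset.mem_insert, Finset.mem_filter,
    Finset.mem_univ, true_and]
  by_cases h1 : i = ⟨m, hm⟩
  · subst h1; simp
  by_cases h2 : i = Fin.last n
  · subst h2
    have : n ≠ m := fun h => h1 (Fin.ext h)
    simp only [Equiv.swap_apply_right, Fin.ext_iff, Fin.val_last]
    omega
  · rw [Equiv.swap_apply_of_ne_of_ne h1 h2]
    have h3 : (i : ℕ) ≠ m := fun h => h1 (Fin.ext h)
    simp only [h2, false_or]
    omega

/-- The expected telescoping sum of log-partition increments, each evaluated at a fresh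
observation, is at most the averaged risk plus a complexity term. -/
lemma integral_sum_logPartition_le {ρ : Measure Λ} [IsProbabilityMeasure ρ] {K : ℝ} (hK : 0 < K)
    (hρ : ρ ≤ ENNReal.ofReal K • π) (hβ : 0 < β) (hq : Measurable (Function.uncurry q))
    (hqB : ∀ z l, |q z l| ≤ B) (n : ℕ) :
    ∫ ζ, ∑ m ∈ Finset.range (n + 1), -β *
      (logPartition π β q (insert (Fin.last n)
          (Finset.univ.filter fun i : Fin (n + 1) => (i : ℕ) < m)) ζ -
        logPartition π β q (Finset.univ.filter fun i : Fin (n + 1) => (i : ℕ) < m) ζ)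
      ∂(Measure.pi fun _ : Fin (n + 1) => P) ≤
    (n + 1) * ∫ w, ∫ l, q w l ∂ρ ∂P + β * Real.log K := by
  have hint := fun s : Finset (Fin (n + 1)) =>
    integrable_logPartition (P := P) (π := π) hβ hq hqB s
  have hdiff : ∀ m ∈ Finset.range (n + 1), Integrable (fun ζ => -β *
      (logPartition π β q (insert (Fin.last n)
          (Finset.univ.filter fun i : Fin (n + 1) => (i : ℕ) < m)) ζ -
        logPartition π β q (Finset.univ.filter fun i : Fin (n + 1) => (i : ℕ) < m) ζ))
      (Measure.pi fun _ : Fin (n + 1) => P) := fun m _ => ((hint _).sub (hint _)).const_mul _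
  rw [integral_finsetSum _ hdiff]
  have hstep : ∀ m ∈ Finset.range (n + 1), ∫ ζ, -β *
      (logPartition π β q (insert (Fin.last n)
          (Finset.univ.filter fun i : Fin (n + 1) => (i : ℕ) < m)) ζ -
        logPartition π β q (Finset.univ.filter fun i : Fin (n + 1) => (i : ℕ) < m) ζ)
      ∂(Measure.pi fun _ : Fin (n + 1) => P) = -β *
      (∫ ζ, logPartition π β q (Finset.univ.filter fun i : Fin (n + 1) => (i : ℕ) < m + 1) ζ
          ∂(Measure.pi fun _ : Fin (n + 1) => P) -
        ∫ ζ, logPartition π β q (Finset.univ.filter fun i : Fin (n + 1) => (i : ℕ) < m) ζ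
          ∂(Measure.pi fun _ : Fin (n + 1) => P)) := fun m hm => by
    rw [integral_const_mul, integral_sub (hint _) (hint _),
      ← map_swap_insert_last (Finset.mem_range.1 hm), integral_logPartition_map]
  rw [Finset.sum_congr rfl hstep, ← Finset.mul_sum, Finset.sum_range_sub (fun m =>
    ∫ ζ, logPartition π β q (Finset.univ.filter fun i : Fin (n + 1) => (i : ℕ) < m) ζ
      ∂(Measure.pi fun _ : Fin (n + 1) => P))]
  have h0 : ∀ ζ : Fin (n + 1) → Z, logPartition π β q
      (Finset.univ.filter fun i : Fin (n + 1) => (i : ℕ) < 0) ζ = 0 := fun ζ => by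
    simp [logPartition]
  have h1 : (Finset.univ.filter fun i : Fin (n + 1) => (i : ℕ) < n + 1) = Finset.univ :=
    Finset.filter_true_of_mem fun i _ => i.isLt
  simp only [h0, h1, integral_zero, sub_zero]
  have hqi : ∀ w, Integrable (q w) ρ := fun w =>
    integrable_of_measurable_of_abs_le (measurable_loss hq w) (hqB w)
  have hwm : StronglyMeasurable fun w => ∫ l, q w l ∂ρ :=
    hq.stronglyMeasurable.integral_prod_right
  have hwi : ∀ i : Fin (n + 1), Integrable (fun ζ : Fin (n + 1) → Z => ∫ l, q (ζ i) l ∂ρ)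
      (Measure.pi fun _ : Fin (n + 1) => P) := fun i =>
    integrable_of_measurable_of_abs_le (hwm.measurable.comp (measurable_pi_apply i)) fun ζ =>
      abs_integral_le_of_abs_le (hqB (ζ i))
  have hrisk : ∫ ζ : Fin (n + 1) → Z, ∑ i, ∫ l, q (ζ i) l ∂ρ
      ∂(Measure.pi fun _ : Fin (n + 1) => P) = (n + 1) * ∫ w, ∫ l, q w l ∂ρ ∂P := by
    rw [integral_finsetSum _ fun i _ => hwi i]
    simp_rw [fun i : Fin (n + 1) => integral_comp_eval (μ := fun _ : Fin (n + 1) => P) (i := i)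
      (f := fun w => ∫ l, q w l ∂ρ) hwm.aestronglyMeasurable]
    simp
  rw [← hrisk, ← integral_const_mul]
  have : ∫ ζ : Fin (n + 1) → Z, (∑ i, ∫ l, q (ζ i) l ∂ρ + β * Real.log K)
      ∂(Measure.pi fun _ : Fin (n + 1) => P) = ∫ ζ : Fin (n + 1) → Z, ∑ i, ∫ l, q (ζ i) l ∂ρ
      ∂(Measure.pi fun _ : Fin (n + 1) => P) + β * Real.log K := by
    rw [integral_add (integrable_finsetSum _ fun i _ => hwi i) (integrable_const _)]
    simp
  rw [← this]
  refine integral_mono ((hint _).const_mul _)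
    ((integrable_finsetSum _ fun i _ => hwi i).add (integrable_const _)) fun ζ => ?_
  simp only
  rw [← integral_finsetSum _ fun i _ => hqi (ζ i)]
  exact neg_mul_log_integral_exp_le hK hρ hβ (measurable_sum_loss hq _ ζ) (abs_sum_loss_le hqB _ ζ)

end LogPartition

section Taylor

lemma le_quadratic_of_deriv2_le {Φ : ℝ → ℝ} (hΦ : ContDiff ℝ 2 Φ) {C r : ℝ}
    (hC : ∀ u, |u| ≤ r → deriv (deriv Φ) u ≤ C) {a v : ℝ} (ha : |a| ≤ r) (hv : |v| ≤ r) :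
    Φ v ≤ Φ a + deriv Φ a * (v - a) + C / 2 * (v - a) ^ 2 := by
  have hd : ∀ u, HasDerivAt Φ (deriv Φ u) u := fun u =>
    (hΦ.differentiable (by norm_num)).differentiableAt.hasDerivAt
  have hd2 : ∀ u, HasDerivAt (deriv Φ) (deriv (deriv Φ) u) u := fun u =>
    ((hΦ.deriv' (n := 1)).differentiable (by norm_num)).differentiableAt.hasDerivAt
  have h1 : ∀ u, HasDerivAt (fun u => C / 2 * u ^ 2 - Φ u) (C * u - deriv Φ u) u := fun u => by
    refine (((hasDerivAt_pow 2 u).const_mul (C / 2)).sub (hd u)).congr_deriv ?_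
    push_cast
    ring
  have h1' : deriv (fun u => C / 2 * u ^ 2 - Φ u) = fun u => C * u - deriv Φ u :=
    funext fun u => (h1 u).deriv
  have h2 : ∀ u, HasDerivAt (fun u => C * u - deriv Φ u) (C - deriv (deriv Φ) u) u := fun u =>
    (((hasDerivAt_id u).const_mul C).sub (hd2 u)).congr_deriv (by rw [mul_one])
  have hconv : ConvexOn ℝ (Set.Icc (-r) r) fun u => C / 2 * u ^ 2 - Φ u := by
    refine convexOn_of_deriv2_nonneg (convex_Icc _ _)
      (fun u _ => (h1 u).continuousAt.continuousWithinAt)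
      (fun u _ => (h1 u).differentiableAt.differentiableWithinAt) ?_ fun u hu => ?_
    · rw [h1']
      exact fun u _ => (h2 u).differentiableAt.differentiableWithinAt
    · rw [interior_Icc] at hu
      simp only [Function.iterate_succ, Function.iterate_zero, Function.comp_apply, id]
      rw [h1', (h2 u).deriv]
      linarith [hC u (abs_le.2 ⟨hu.1.le, hu.2.le⟩)]
  have key : (C * a - deriv Φ a) * (v - a) ≤
      (C / 2 * v ^ 2 - Φ v) - (C / 2 * a ^ 2 - Φ a) := by
    rcases lt_trichotomy a v with h | h | h
    · have := hconv.le_slope_of_hasDerivAt (abs_le.1 ha) (abs_le.1 hv) h (h1 a)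
      rwa [slope_def_field, le_div_iff₀ (sub_pos.2 h)] at this
    · subst h; simp
    · have := hconv.slope_le_of_hasDerivAt (abs_le.1 hv) (abs_le.1 ha) h (h1 a)
      rw [slope_def_field, div_le_iff₀ (sub_pos.2 h)] at this
      linarith
  nlinarith

variable {M : ℕ}

lemma abs_sum_mul_le {R L : ℝ} {l b : Fin M → ℝ} (hl : ∑ j, |l j| ≤ R) (hL : 0 ≤ L)
    (hb : ∀ j, |b j| ≤ L) : |∑ j, l j * b j| ≤ R * L := by
  refine (Finset.abs_sum_le_sum_abs _ _).trans ?_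
  calc ∑ j, |l j * b j| ≤ ∑ j, |l j| * L := Finset.sum_le_sum fun j _ => by
        rw [abs_mul]; exact mul_le_mul_of_nonneg_left (hb j) (abs_nonneg _)
    _ ≤ R * L := by rw [← Finset.sum_mul]; exact mul_le_mul_of_nonneg_right hl hL

/-- Averaging a smooth loss over a centred random parameter with uncorrelated coordinates. -/
lemma integral_comp_sum_le {ρ : Measure (Fin M → ℝ)} [IsProbabilityMeasure ρ] {R L s C : ℝ}
    {a b : Fin M → ℝ} (hρ : ∀ᵐ l ∂ρ, ∑ j, |l j| ≤ R) (ha : ∑ j, |a j| ≤ R) (hL : 0 ≤ L)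
    (hb : ∀ j, |b j| ≤ L) (hm1 : ∀ j, ∫ l, (l j - a j) ∂ρ = 0)
    (hm2 : ∀ i j, i ≠ j → ∫ l, (l i - a i) * (l j - a j) ∂ρ = 0)
    (hm3 : ∀ j, ∫ l, (l j - a j) ^ 2 ∂ρ ≤ s) {Φ : ℝ → ℝ} (hΦ0 : ∀ u, 0 ≤ Φ u)
    (hΦ : ContDiff ℝ 2 Φ) (hC : ∀ u, |u| ≤ R * L → deriv (deriv Φ) u ≤ C) (hC0 : 0 ≤ C) :
    ∫ l, Φ (∑ j, l j * b j) ∂ρ ≤ Φ (∑ j, a j * b j) + C / 2 * s * ∑ j, b j ^ 2 := by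
  have hcoord : ∀ᵐ l ∂ρ, ∀ j, |l j - a j| ≤ 2 * R := hρ.mono fun l hl j => by
    have h1 := Finset.single_le_sum (f := fun j => |l j|) (fun j _ => abs_nonneg _)
      (Finset.mem_univ j)
    have h2 := Finset.single_le_sum (f := fun j => |a j|) (fun j _ => abs_nonneg _)
      (Finset.mem_univ j)
    have h3 := abs_sub (l j) (a j)
    linarith
  have hi1 : ∀ j, Integrable (fun l : Fin M → ℝ => l j - a j) ρ := fun j =>
    Integrable.of_bound (Measurable.aestronglyMeasurable (by fun_prop)) (2 * R)
      (hcoord.mono fun l hl => hl j)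
  have hi2 : ∀ i j, Integrable (fun l : Fin M → ℝ => (l i - a i) * (l j - a j)) ρ := fun i j =>
    Integrable.of_bound (Measurable.aestronglyMeasurable (by fun_prop)) (2 * R * (2 * R))
      (hcoord.mono fun l hl => by
        rw [norm_mul]
        exact mul_le_mul (hl i) (hl j) (norm_nonneg _) ((abs_nonneg _).trans (hl i)))
  have hlin : ∀ l : Fin M → ℝ, ∑ j, l j * b j - ∑ j, a j * b j = ∑ j, b j * (l j - a j) :=
    fun l => by
      rw [← Finset.sum_sub_distrib]
      exact Finset.sum_congr rfl fun j _ => by ring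
  have hquad : ∀ l : Fin M → ℝ, (∑ j, b j * (l j - a j)) ^ 2 =
      ∑ i, ∑ j, b i * b j * ((l i - a i) * (l j - a j)) := fun l => by
    rw [sq, Finset.sum_mul_sum]
    exact Finset.sum_congr rfl fun i _ => Finset.sum_congr rfl fun j _ => by ring
  have hI1 : Integrable (fun l : Fin M → ℝ => ∑ j, b j * (l j - a j)) ρ :=
    integrable_finsetSum _ fun j _ => (hi1 j).const_mul _
  have hI2' : ∀ i, Integrable
      (fun l : Fin M → ℝ => ∑ j, b i * b j * ((l i - a i) * (l j - a j))) ρ := fun i =>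
    integrable_finsetSum _ fun j _ => (hi2 i j).const_mul _
  have hI2 : Integrable (fun l : Fin M → ℝ => (∑ j, b j * (l j - a j)) ^ 2) ρ := by
    simp_rw [hquad]
    exact integrable_finsetSum _ fun i _ => hI2' i
  have hE1 : ∫ l, ∑ j, b j * (l j - a j) ∂ρ = 0 := by
    rw [integral_finsetSum _ fun j _ => (hi1 j).const_mul _]
    simp [integral_const_mul, hm1]
  have hE2 : ∫ l, (∑ j, b j * (l j - a j)) ^ 2 ∂ρ ≤ s * ∑ j, b j ^ 2 := by
    simp_rw [hquad]
    rw [integral_finsetSum _ fun i _ => hI2' i, Finset.mul_sum]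
    refine Finset.sum_le_sum fun i _ => ?_
    rw [integral_finsetSum _ fun j _ => (hi2 i j).const_mul _]
    simp_rw [integral_const_mul]
    rw [Finset.sum_eq_single i (fun j _ hj => by rw [hm2 i j hj.symm, mul_zero])
      (fun h => absurd (Finset.mem_univ i) h)]
    have := mul_le_mul_of_nonneg_left (hm3 i) (sq_nonneg (b i))
    simp_rw [sq] at this ⊢
    linarith
  set A := ∑ j, a j * b j
  have hA : |A| ≤ R * L := abs_sum_mul_le ha hL hb
  calc ∫ l, Φ (∑ j, l j * b j) ∂ρ
      ≤ ∫ l, (Φ A + deriv Φ A * ∑ j, b j * (l j - a j) +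
          C / 2 * (∑ j, b j * (l j - a j)) ^ 2) ∂ρ := by
        refine integral_mono_of_nonneg (Filter.Eventually.of_forall fun l => hΦ0 _)
          (((integrable_const _).add (hI1.const_mul _)).add (hI2.const_mul _)) (hρ.mono fun l hl => ?_)
        have := le_quadratic_of_deriv2_le hΦ hC hA (abs_sum_mul_le hl hL hb)
        rwa [hlin] at this
    _ = Φ A + C / 2 * ∫ l, (∑ j, b j * (l j - a j)) ^ 2 ∂ρ := by
        have hI3 : Integrable (fun l : Fin M → ℝ => Φ A + deriv Φ A * ∑ j, b j * (l j - a j)) ρ :=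
          (integrable_const _).add (hI1.const_mul _)
        rw [integral_add hI3 (hI2.const_mul _),
          integral_add (integrable_const _) (hI1.const_mul _), integral_const_mul,
          integral_const_mul, hE1]
        simp
    _ ≤ _ := by
        rw [mul_assoc]
        gcongr

end Taylor

lemma ae_sparsityPrior {M : ℕ} {τ R c : ℝ} {π : Measure (Fin M → ℝ)}
    (hπ : π = volume.withDensity fun l => ENNReal.ofReal
      (if (∑ j, |l j|) ≤ R then c * ∏ j, ((τ ^ 2 + l j ^ 2) ^ 2)⁻¹ else 0)) :
    ∀ᵐ l ∂π, ∑ j, |l j| ≤ R := by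
  rw [hπ, ae_withDensity_iff]
  · refine Filter.Eventually.of_forall fun l hl => ?_
    by_contra h
    exact hl (by rw [if_neg h, ENNReal.ofReal_zero])
  · exact (Measurable.ite (measurableSet_le (by fun_prop) measurable_const)
      (by fun_prop) measurable_const).ennreal_ofReal

lemma integral_integral_pi_eq_integral_pi_succ {Z : Type*} [MeasurableSpace Z] {P : Measure Z}
    [IsProbabilityMeasure P] {n : ℕ} {F : (Fin n → Z) → Z → ℝ}
    (hF : Measurable (Function.uncurry F)) {B : ℝ} (hB : ∀ z w, |F z w| ≤ B) :
    ∫ z, ∫ w, F z w ∂P ∂(Measure.pi fun _ : Fin n => P) =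
      ∫ ζ, F (fun i => ζ i.castSucc) (ζ (Fin.last n)) ∂(Measure.pi fun _ : Fin (n + 1) => P) := by
  have h := (measurePreserving_piFinSuccAbove (fun _ : Fin (n + 1) => P)
    (Fin.last n)).integral_comp' fun p => F p.2 p.1
  have hi : Integrable (fun p : Z × (Fin n → Z) => F p.2 p.1)
      (P.prod (Measure.pi fun _ : Fin n => P)) :=
    integrable_of_measurable_of_abs_le (hF.comp measurable_swap) fun p => hB p.2 p.1
  rw [integral_prod_symm _ hi] at h
  rw [← h]
  congr 1 with ζ
  simp only [MeasurableEquiv.piFinSuccAbove_apply, Fin.insertNthEquiv_last, Fin.snocEquiv_symm_apply]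
  rfl

lemma sum_filter_castSucc_lt {n m : ℕ} (hm : m ≤ n) (g : Fin (n + 1) → ℝ) :
    ∑ i ∈ Finset.univ.filter (fun i : Fin n => (i : ℕ) < m), g i.castSucc =
      ∑ i ∈ Finset.univ.filter (fun i : Fin (n + 1) => (i : ℕ) < m), g i := by
  rw [Finset.sum_filter, Finset.sum_filter, Fin.sum_univ_castSucc]
  simp [hm.not_gt]

/-- Proposition 4: In binary classification with a smooth convex loss `Φ`
satisfying `β_Φ := sup_{|u| ≤ RL_φ} Φ′(u)²/Φ″(u) < ∞` (convention 0/0 = 0, encoded by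
`Φ′(u)² ≤ β Φ″(u)` on `|u| ≤ RL_φ`, which is exactly `β ≥ β_Φ`), the mirror averaging
aggregate with the sparsity prior and temperature `β ≥ β_Φ` satisfies the stated sparsity
oracle inequality for the excess Φ-risk, with `C_Φ = 4·max_{|u| ≤ RL_φ} Φ″(u)`. -/
theorem ma_classification_soi
    {X : Type} [MeasurableSpace X]
    (n M : ℕ) (hM : 2 ≤ M)
    (τ R : ℝ) (hτ : 0 < τ) (hR : 2 * M * τ < R)
    -- the joint law of (X₁, Y₁) on 𝒳 × {−1, +1}
    (P : Measure (X × ℝ)) [IsProbabilityMeasure P]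
    (hlabels : ∀ᵐ z ∂P, z.2 = 1 ∨ z.2 = -1)
    (PX : Measure X) (hPX : PX = P.map Prod.fst)
    -- the regression function η(x) = E(Y₁ | X₁ = x)
    (η : X → ℝ) (hηmeas : Measurable η)
    (hη : ∀ A : Set X, MeasurableSet A →
      (∫ z in {z : X × ℝ | z.1 ∈ A}, z.2 ∂P) = ∫ x in A, η x ∂PX)
    -- the dictionary, bounded by L_φ
    (φ : Fin M → X → ℝ) (hφmeas : ∀ j, Measurable (φ j))
    (Lφ : ℝ) (hLφ : 0 < Lφ)
    (hφbound : ∀ j, ∀ᵐ x ∂PX, |φ j x| ≤ Lφ)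
    (hφ2 : ∀ j, Integrable (fun x => φ j x ^ 2) PX)
    (flam : (Fin M → ℝ) → X → ℝ)
    (hflam : ∀ (l : Fin M → ℝ) (x : X), flam l x = ∑ j, l j * φ j x)
    -- the loss Φ : convex, nonnegative, twice continuously differentiable
    (Φ : ℝ → ℝ) (hΦnn : ∀ u, 0 ≤ Φ u) (hΦconv : ConvexOn ℝ Set.univ Φ)
    (hΦsmooth : ContDiff ℝ 2 Φ)
    -- f_Φ minimizes the Φ-risk pointwise
    (fΦ : X → ℝ) (hfΦmeas : Measurable fΦ)
    (hfΦ : ∀ x : X, ∀ u : ℝ,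
      Φ (-fΦ x) * (1 + η x) + Φ (fΦ x) * (1 - η x) ≤
        Φ (-u) * (1 + η x) + Φ u * (1 - η x))
    -- temperature β ≥ β_Φ and the constant C_Φ
    (β : ℝ) (hβpos : 0 < β)
    (hβΦ : ∀ u : ℝ, |u| ≤ R * Lφ → deriv Φ u ^ 2 ≤ β * deriv (deriv Φ) u)
    (CΦ : ℝ)
    (hCΦ : CΦ = 4 * sSup (deriv (deriv Φ) '' Set.Icc (-(R * Lφ)) (R * Lφ)))
    -- the sparsity prior (with normalizing constant c)
    (c : ℝ) (hc : 0 < c)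
    (π : Measure (Fin M → ℝ))
    (hπ : π = volume.withDensity fun l => ENNReal.ofReal
      (if (∑ j, |l j|) ≤ R then c * ∏ j, ((τ ^ 2 + l j ^ 2) ^ 2)⁻¹ else 0))
    (hπprob : IsProbabilityMeasure π)
    -- the mirror averaging aggregate with Q(z,g) = Φ(−y g(x))
    (θ : ℕ → (Fin n → X × ℝ) → (Fin M → ℝ) → ℝ)
    (hθ : ∀ (m : ℕ) (z : Fin n → X × ℝ) (l : Fin M → ℝ), θ m z l =
      Real.exp (-(∑ i ∈ Finset.univ.filter (fun i : Fin n => (i : ℕ) < m),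
          Φ (-(z i).2 * flam l (z i).1)) / β) /
        ∫ w, Real.exp (-(∑ i ∈ Finset.univ.filter (fun i : Fin n => (i : ℕ) < m),
          Φ (-(z i).2 * flam w (z i).1)) / β) ∂π)
    (fhat : (Fin n → X × ℝ) → X → ℝ)
    (hfhat : ∀ (z : Fin n → X × ℝ) (x : X), fhat z x =
      ((n : ℝ) + 1)⁻¹ * ∑ m ∈ Finset.range (n + 1), ∫ l, θ m z l * flam l x ∂π) :
    ∀ lstar : Fin M → ℝ, (∑ j, |lstar j|) ≤ R - 2 * M * τ →
      (∫ z, ((∫ w, Φ (-w.2 * fhat z w.1) ∂P) - ∫ w, Φ (-w.2 * fΦ w.1) ∂P)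
          ∂(Measure.pi fun _ : Fin n => P)) ≤
        ((∫ w, Φ (-w.2 * flam lstar w.1) ∂P) - ∫ w, Φ (-w.2 * fΦ w.1) ∂P) +
          (4 * β / (n + 1)) * (∑ j, Real.log (1 + τ⁻¹ * |lstar j|)) +
          (CΦ * τ ^ 2 * (∑ j, ∫ x, φ j x ^ 2 ∂PX) + β / (n + 1)) := by
  classical
  intro a ha
  have hM0 : 0 < M := by omega
  have hMτ : 0 ≤ 2 * M * τ := by positivity
  have hR0 : 0 < R := hMτ.trans_lt hR
  set r : ℝ := R * Lφ with hr
  have hr0 : 0 ≤ r := by positivity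
  have hΦc : Continuous Φ := hΦsmooth.continuous
  have hconc := concaveOn_exp_neg_div hΦsmooth hβpos hβΦ
  -- truncated losses
  set clamp : ℝ → ℝ := fun v => max (-r) (min r v) with hclamp
  have hclampm : Measurable clamp := by fun_prop
  have hclamp_le : ∀ v, |clamp v| ≤ r := fun v =>
    abs_le.2 ⟨le_max_left _ _, max_le (by linarith) (min_le_left _ _)⟩
  have hclamp_eq : ∀ v, |v| ≤ r → clamp v = v := fun v hv => by
    simp only [hclamp]
    rw [min_eq_right (abs_le.1 hv).2, max_eq_right (abs_le.1 hv).1]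
  obtain ⟨B, hB⟩ := isCompact_Icc.exists_bound_of_continuousOn
    (hΦc.continuousOn (s := Set.Icc (-r) r))
  have hΦB : ∀ v, |Φ (clamp v)| ≤ B := fun v => hB _ (abs_le.1 (hclamp_le v))
  set q : X × ℝ → (Fin M → ℝ) → ℝ := fun w l => Φ (clamp (-w.2 * flam l w.1)) with hq
  have hqB : ∀ w l, |q w l| ≤ B := fun w l => hΦB _
  -- measurability
  have hflam_m : Measurable fun p : (Fin M → ℝ) × X => flam p.1 p.2 := by
    simp_rw [hflam]
    exact Finset.measurable_fun_sum _ fun j _ => ((measurable_pi_apply j).comp measurable_fst).mul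
      ((hφmeas j).comp measurable_snd)
  have hmarg_m : Measurable fun p : (X × ℝ) × (Fin M → ℝ) => -p.1.2 * flam p.2 p.1.1 := by
    have h1 : Measurable fun p : (X × ℝ) × (Fin M → ℝ) => (p.2, p.1.1) := by fun_prop
    exact (measurable_snd.comp measurable_fst).neg.mul (hflam_m.comp h1)
  have hqm : Measurable (Function.uncurry q) := hΦc.measurable.comp (hclampm.comp hmarg_m)
  have hθ_m : ∀ m, Measurable fun p : (Fin n → X × ℝ) × (Fin M → ℝ) => θ m p.1 p.2 := fun m => by
    have h1 : Measurable fun p : (Fin n → X × ℝ) × (Fin M → ℝ) =>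
        Real.exp (-(∑ i ∈ Finset.univ.filter (fun i : Fin n => (i : ℕ) < m),
          Φ (-(p.1 i).2 * flam p.2 (p.1 i).1)) / β) := by
      have h2 : Measurable fun p : (Fin n → X × ℝ) × (Fin M → ℝ) =>
          ∑ i ∈ Finset.univ.filter (fun i : Fin n => (i : ℕ) < m),
            Φ (-(p.1 i).2 * flam p.2 (p.1 i).1) :=
        Finset.measurable_fun_sum _ fun i _ => by
          have h3 : Measurable fun p : (Fin n → X × ℝ) × (Fin M → ℝ) => (p.1 i, p.2) := by
            fun_prop
          exact hΦc.measurable.comp (hmarg_m.comp h3)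
      exact (h2.neg.div_const β).exp
    simp_rw [hθ]
    exact h1.div ((StronglyMeasurable.integral_prod_right
      (f := fun (z : Fin n → X × ℝ) (l : Fin M → ℝ) =>
        Real.exp (-(∑ i ∈ Finset.univ.filter (fun i : Fin n => (i : ℕ) < m),
          Φ (-(z i).2 * flam l (z i).1)) / β)) h1.stronglyMeasurable).measurable.comp
            measurable_fst)
  have hfhat_m : Measurable fun p : (Fin n → X × ℝ) × (X × ℝ) => fhat p.1 p.2.1 := by
    simp_rw [hfhat]
    refine (Finset.measurable_fun_sum _ fun m _ => ?_).const_mul _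
    refine (StronglyMeasurable.integral_prod_right
      (f := fun (p : (Fin n → X × ℝ) × (X × ℝ)) (l : Fin M → ℝ) =>
        θ m p.1 l * flam l p.2.1) (Measurable.stronglyMeasurable ?_)).measurable
    have h1 : Measurable fun p : ((Fin n → X × ℝ) × (X × ℝ)) × (Fin M → ℝ) => (p.1.1, p.2) := by
      fun_prop
    have h2 : Measurable fun p : ((Fin n → X × ℝ) × (X × ℝ)) × (Fin M → ℝ) => (p.2, p.1.2.1) := by
      fun_prop
    exact ((hθ_m m).comp h1).mul (hflam_m.comp h2)
  set F : (Fin n → X × ℝ) → X × ℝ → ℝ := fun z w => Φ (clamp (-w.2 * fhat z w.1)) with hF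
  have hFm : Measurable (Function.uncurry F) :=
    hΦc.measurable.comp (hclampm.comp ((measurable_snd.comp measurable_snd).neg.mul hfhat_m))
  -- almost every observation is regular
  set G : X × ℝ → Prop := fun w => (w.2 = 1 ∨ w.2 = -1) ∧ ∀ j, |φ j w.1| ≤ Lφ with hG
  have hGae : ∀ᵐ w ∂P, G w := by
    refine hlabels.and (ae_all_iff.2 fun j => ?_)
    have := hφbound j
    rw [hPX] at this
    exact ae_of_ae_map measurable_fst.aemeasurable this
  have hGpi : ∀ k : ℕ, ∀ᵐ ζ ∂(Measure.pi fun _ : Fin k => P), ∀ i, G (ζ i) := fun k =>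
    ae_all_iff.2 fun i => (Measure.tendsto_eval_ae_ae (μ := fun _ : Fin k => P)).eventually hGae
  have hlin : ∀ (w : X × ℝ) (l : Fin M → ℝ),
      -w.2 * flam l w.1 = ∑ j, l j * (-w.2 * φ j w.1) := fun w l => by
    rw [hflam, Finset.mul_sum]
    exact Finset.sum_congr rfl fun j _ => by ring
  have hcoef : ∀ w, G w → ∀ j, |-w.2 * φ j w.1| ≤ Lφ := fun w hw j => by
    have : |w.2| = 1 := by rcases hw.1 with h | h <;> simp [h]
    rw [abs_mul, abs_neg, this, one_mul]
    exact hw.2 j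
  have hmarg : ∀ w, G w → ∀ l : Fin M → ℝ, ∑ j, |l j| ≤ R → |-w.2 * flam l w.1| ≤ r :=
    fun w hw l hl => by
      rw [hlin]
      exact abs_sum_mul_le hl hLφ.le (hcoef w hw)
  have hqeq : ∀ w, G w → ∀ l : Fin M → ℝ, ∑ j, |l j| ≤ R → q w l = Φ (-w.2 * flam l w.1) :=
    fun w hw l hl => by simp only [hq, hclamp_eq _ (hmarg w hw l hl)]
  have hπR := ae_sparsityPrior hπ
  -- pointwise bound for the loss of the aggregate at a fresh observation
  have hpt : ∀ ζ : Fin (n + 1) → X × ℝ, (∀ i, G (ζ i)) →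
      |-(ζ (Fin.last n)).2 * fhat (fun i => ζ i.castSucc) (ζ (Fin.last n)).1| ≤ r ∧
      Φ (-(ζ (Fin.last n)).2 * fhat (fun i => ζ i.castSucc) (ζ (Fin.last n)).1) ≤
        ((n : ℝ) + 1)⁻¹ * ∑ m ∈ Finset.range (n + 1), -β *
          (logPartition π β q (insert (Fin.last n)
            (Finset.univ.filter fun i : Fin (n + 1) => (i : ℕ) < m)) ζ -
          logPartition π β q (Finset.univ.filter fun i : Fin (n + 1) => (i : ℕ) < m) ζ) := by
    intro ζ hζ
    set w := ζ (Fin.last n) with hw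
    set u : (Fin M → ℝ) → ℝ := fun l => clamp (-w.2 * flam l w.1) with hu
    have hum : Measurable u := hclampm.comp (hmarg_m.comp (measurable_const.prodMk measurable_id))
    set S : ℕ → (Fin M → ℝ) → ℝ := fun m l =>
      ∑ i ∈ Finset.univ.filter (fun i : Fin (n + 1) => (i : ℕ) < m), q (ζ i) l with hS
    set μ : ℕ → ℝ := fun m =>
      ∫ l, Real.exp (-S m l / β) / (∫ v, Real.exp (-S m v / β) ∂π) * u l ∂π with hμ
    have hgibbs := fun m => gibbs_mean_bounds (π := π) hβpos
      (measurable_sum_loss hqm (Finset.univ.filter fun i : Fin (n + 1) => (i : ℕ) < m) ζ) hum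
      (abs_sum_loss_le hqB _ ζ) (fun l => hclamp_le _) hΦc hconc
    have hexp : ∀ m ≤ n, ∀ᵐ l ∂π, Real.exp (-(∑ i ∈ Finset.univ.filter
        (fun i : Fin n => (i : ℕ) < m), Φ (-(ζ i.castSucc).2 * flam l (ζ i.castSucc).1)) / β) =
        Real.exp (-S m l / β) := fun m hm => hπR.mono fun l hl => by
      rw [sum_filter_castSucc_lt hm fun i => Φ (-(ζ i).2 * flam l (ζ i).1)]
      simp only [hS, fun i => hqeq (ζ i) (hζ i) l hl]
    have hmean : -w.2 * fhat (fun i => ζ i.castSucc) w.1 =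
        ∑ m ∈ Finset.range (n + 1), ((n : ℝ) + 1)⁻¹ * μ m := by
      rw [hfhat, ← Finset.mul_sum, mul_left_comm, Finset.mul_sum]
      congr 1
      refine Finset.sum_congr rfl fun m hm => ?_
      have hmn : m ≤ n := Nat.lt_succ_iff.1 (Finset.mem_range.1 hm)
      rw [← integral_const_mul]
      refine integral_congr_ae ?_
      filter_upwards [hexp m hmn, hπR] with l hl hlR
      rw [hθ, hl, integral_congr_ae (hexp m hmn),
        show u l = -w.2 * flam l w.1 from hclamp_eq _ (hmarg w (hζ _) l hlR)]
      ring
    have hn1 : (0 : ℝ) < (n : ℝ) + 1 := by positivity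
    have hsum1 : ∑ m ∈ Finset.range (n + 1), ((n : ℝ) + 1)⁻¹ = 1 := by
      rw [Finset.sum_const, Finset.card_range, nsmul_eq_mul]
      push_cast
      exact mul_inv_cancel₀ hn1.ne'
    have hinc : ∀ m ∈ Finset.range (n + 1), Φ (μ m) ≤ -β *
        (logPartition π β q (insert (Fin.last n)
            (Finset.univ.filter fun i : Fin (n + 1) => (i : ℕ) < m)) ζ -
          logPartition π β q (Finset.univ.filter fun i : Fin (n + 1) => (i : ℕ) < m) ζ) :=
      fun m hm => by
        have hnot : Fin.last n ∉ Finset.univ.filter fun i : Fin (n + 1) => (i : ℕ) < m := by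
          have := Finset.mem_range.1 hm
          simp only [Finset.mem_filter, Finset.mem_univ, true_and, Fin.val_last]
          omega
        simp only [logPartition, Finset.sum_insert hnot]
        simp only [add_comm (q (ζ (Fin.last n)) _)]
        exact (hgibbs m).2
    rw [hmean]
    constructor
    · calc |∑ m ∈ Finset.range (n + 1), ((n : ℝ) + 1)⁻¹ * μ m|
          ≤ ∑ m ∈ Finset.range (n + 1), |((n : ℝ) + 1)⁻¹ * μ m| := Finset.abs_sum_le_sum_abs _ _
        _ ≤ ∑ m ∈ Finset.range (n + 1), ((n : ℝ) + 1)⁻¹ * r := Finset.sum_le_sum fun m _ => by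
            rw [abs_mul, abs_of_pos (inv_pos.2 hn1)]
            exact mul_le_mul_of_nonneg_left (hgibbs m).1 (inv_pos.2 hn1).le
        _ = r := by rw [← Finset.sum_mul, hsum1, one_mul]
    · have hJ := hΦconv.map_sum_le (t := Finset.range (n + 1)) (w := fun _ => ((n : ℝ) + 1)⁻¹)
        (p := μ) (fun _ _ => (inv_pos.2 hn1).le) hsum1 fun _ _ => Set.mem_univ _
      simp only [smul_eq_mul] at hJ
      refine hJ.trans ?_
      rw [← Finset.mul_sum]
      exact mul_le_mul_of_nonneg_left (Finset.sum_le_sum hinc) (inv_pos.2 hn1).le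
  -- the perturbation of the oracle
  obtain ⟨ρ, hρprob, hρle, hρR, hm1, hm2, hm3⟩ :=
    exists_centered_le_smul_sparsityPrior hM0 hτ hc hπ hπprob a ha
  set K : ℝ := 2 * ∏ j, (1 + τ⁻¹ * |a j|) ^ 4 with hK
  have hfac : ∀ j, 0 < 1 + τ⁻¹ * |a j| := fun j => by positivity
  have hK0 : 0 < K := mul_pos two_pos (Finset.prod_pos fun j _ => pow_pos (hfac j) 4)
  have hlogK : Real.log K ≤ 1 + 4 * ∑ j, Real.log (1 + τ⁻¹ * |a j|) := by
    rw [hK, Real.log_mul two_ne_zero (Finset.prod_pos fun j _ => pow_pos (hfac j) 4).ne',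
      Real.log_prod fun j _ => (pow_pos (hfac j) 4).ne', Finset.mul_sum]
    have h2 : Real.log 2 ≤ 1 := by linarith [Real.log_two_lt_d9]
    refine add_le_add h2 (Finset.sum_le_sum fun j _ => ?_)
    rw [Real.log_pow]
    norm_num
  have haR : ∑ j, |a j| ≤ R := by linarith
  -- the curvature constant
  have hΦ2c : Continuous (deriv (deriv Φ)) :=
    ((hΦsmooth.deriv' (n := 1)).deriv' (n := 0)).continuous
  have hcurv : ∀ u, |u| ≤ r → deriv (deriv Φ) u ≤ CΦ / 4 := fun u hu => by
    rw [hCΦ, mul_div_cancel_left₀ _ four_ne_zero]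
    exact le_csSup (isCompact_Icc.image hΦ2c).bddAbove (Set.mem_image_of_mem _ (abs_le.1 hu))
  have hC0 : 0 ≤ CΦ / 4 := by
    have h0 : |(0 : ℝ)| ≤ r := by rwa [abs_zero]
    refine le_trans ?_ (hcurv 0 h0)
    exact nonneg_of_mul_nonneg_right ((sq_nonneg _).trans (hβΦ 0 h0)) hβpos
  have hrisk : ∫ w, ∫ l, q w l ∂ρ ∂P ≤
      (∫ w, Φ (-w.2 * flam a w.1) ∂P) + CΦ * τ ^ 2 * ∑ j, ∫ x, φ j x ^ 2 ∂PX := by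
    have hφP : ∀ j, Integrable (fun w : X × ℝ => φ j w.1 ^ 2) P := fun j => by
      have := hφ2 j
      rw [hPX] at this
      exact this.comp_measurable measurable_fst
    have hφI : ∀ j, ∫ x, φ j x ^ 2 ∂PX = ∫ w : X × ℝ, φ j w.1 ^ 2 ∂P := fun j => by
      rw [hPX, integral_map measurable_fst.aemeasurable
        ((hφmeas j).pow_const 2).aestronglyMeasurable]
    have hqa : Integrable (fun w => Φ (-w.2 * flam a w.1)) P := by
      refine Integrable.of_bound (hΦc.measurable.comp (hmarg_m.comp
        (measurable_id.prodMk measurable_const))).aestronglyMeasurable B (hGae.mono fun w hw => ?_)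
      exact hB _ (abs_le.1 (hmarg w hw a haR))
    simp_rw [hφI]
    rw [← integral_finsetSum _ fun j _ => hφP j, ← integral_const_mul,
      ← integral_add hqa ((integrable_finsetSum _ fun j _ => hφP j).const_mul _)]
    refine integral_mono_ae (integrable_of_measurable_of_abs_le
      hqm.stronglyMeasurable.integral_prod_right.measurable
      fun w => abs_integral_le_of_abs_le fun l => hΦB _)
      (hqa.add ((integrable_finsetSum _ fun j _ => hφP j).const_mul _)) (hGae.mono fun w hw => ?_)
    have h := integral_comp_sum_le hρR haR hLφ.le (hcoef w hw) hm1 hm2 hm3 hΦnn hΦsmooth hcurv hC0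
    have e1 : ∫ l, q w l ∂ρ = ∫ l, Φ (∑ j, l j * (-w.2 * φ j w.1)) ∂ρ :=
      integral_congr_ae (hρR.mono fun l hl => by rw [hqeq w hw l hl, hlin])
    have e2 : ∑ j, (-w.2 * φ j w.1) ^ 2 = ∑ j, φ j w.1 ^ 2 := by
      have : w.2 ^ 2 = 1 := by rcases hw.1 with h | h <;> simp [h]
      refine Finset.sum_congr rfl fun j _ => ?_
      rw [mul_pow, neg_sq, this, one_mul]
    rw [e2, ← hlin, ← e1] at h
    refine h.trans (add_le_add_right (mul_le_mul_of_nonneg_right ?_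
      (Finset.sum_nonneg fun j _ => sq_nonneg _)) _)
    nlinarith [mul_nonneg hC0 (sq_nonneg τ)]
  -- assembling
  have hFeq : ∫ z, ((∫ w, Φ (-w.2 * fhat z w.1) ∂P) - ∫ w, Φ (-w.2 * fΦ w.1) ∂P)
      ∂(Measure.pi fun _ : Fin n => P) =
      (∫ z, ∫ w, F z w ∂P ∂(Measure.pi fun _ : Fin n => P)) - ∫ w, Φ (-w.2 * fΦ w.1) ∂P := by
    have hFi : Integrable (fun z => ∫ w, F z w ∂P) (Measure.pi fun _ : Fin n => P) :=
      integrable_of_measurable_of_abs_le hFm.stronglyMeasurable.integral_prod_right.measurable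
        fun z => abs_integral_le_of_abs_le fun w => hΦB _
    have e : ∀ᵐ z ∂(Measure.pi fun _ : Fin n => P),
        (∫ w, Φ (-w.2 * fhat z w.1) ∂P) - ∫ w, Φ (-w.2 * fΦ w.1) ∂P =
        (∫ w, F z w ∂P) - ∫ w, Φ (-w.2 * fΦ w.1) ∂P := (hGpi n).mono fun z hz => by
      congr 1
      refine integral_congr_ae (hGae.mono fun w hw => ?_)
      have h := (hpt (Fin.snoc (α := fun _ => X × ℝ) z w) fun i => by
        refine Fin.lastCases ?_ (fun j => ?_) i
        · rwa [Fin.snoc_last]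
        · rw [Fin.snoc_castSucc]; exact hz j).1
      simp only [Fin.snoc_last, Fin.snoc_castSucc] at h
      simp only [hF, hclamp_eq _ h]
    rw [integral_congr_ae e, integral_sub hFi (integrable_const _), integral_const]
    simp
  have hbound : ∫ z, ∫ w, F z w ∂P ∂(Measure.pi fun _ : Fin n => P) ≤
      ((n : ℝ) + 1)⁻¹ * ((n + 1) * ∫ w, ∫ l, q w l ∂ρ ∂P + β * Real.log K) := by
    rw [integral_integral_pi_eq_integral_pi_succ hFm fun z w => hΦB _]
    refine le_trans ?_ (mul_le_mul_of_nonneg_left (integral_sum_logPartition_le (P := P) hK0 hρle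
      hβpos hqm hqB n) (by positivity))
    rw [← integral_const_mul]
    have hint := fun s : Finset (Fin (n + 1)) =>
      integrable_logPartition (P := P) (π := π) hβpos hqm hqB s
    refine integral_mono_ae (integrable_of_measurable_of_abs_le (hFm.comp (Measurable.prodMk
      (by fun_prop) (measurable_pi_apply _))) fun ζ => hΦB _)
      ((integrable_finsetSum _ fun m _ => ((hint _).sub (hint _)).const_mul _).const_mul _)
      ((hGpi (n + 1)).mono fun ζ hζ => ?_)
    have h := hpt ζ hζ
    simp only [hF, hclamp_eq _ h.1]
    exact h.2
  have hn1 : (0 : ℝ) < (n : ℝ) + 1 := by positivity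
  rw [hFeq]
  have hfin : ((n : ℝ) + 1)⁻¹ * ((n + 1) * ∫ w, ∫ l, q w l ∂ρ ∂P + β * Real.log K) ≤
      (∫ w, Φ (-w.2 * flam a w.1) ∂P) + CΦ * τ ^ 2 * ∑ j, ∫ x, φ j x ^ 2 ∂PX +
        (4 * β / (n + 1) * ∑ j, Real.log (1 + τ⁻¹ * |a j|) + β / (n + 1)) := by
    rw [mul_add, inv_mul_cancel_left₀ hn1.ne']
    refine add_le_add hrisk ?_
    calc ((n : ℝ) + 1)⁻¹ * (β * Real.log K)
        ≤ ((n : ℝ) + 1)⁻¹ * (β * (1 + 4 * ∑ j, Real.log (1 + τ⁻¹ * |a j|))) := by gcongr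
      _ = _ := by ring
  linarith
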